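/- arXiv:1202.1217 — 6 statements merged into one kernel-verified Lean document; each statement's English description precedes it below -/
import Mathlib

section
/- Let U ⊆ ℝ² be open, let u : U → ℝ be twice continuously differentiable, let Z = (Z₁,Z₂) : U → ℝ² be a continuously differentiable vector field, and let H ∈ ℝ. Define the matrix field Q by Q_{ij} = (∂₁Z₁ + ∂₂Z₂ − 2H)δ_{ij} − (∂_i Z_j + ∂_j Z_i), i,j ∈ {1,2}. Then at every point of U the following pointwise identity holds: 2(Z·∇u + H u)Δu = 2 div((Z·∇u + H u)∇u) + (Q∇u)·∇u − div(|∇u|² Z). -/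
open Set

/-- First partial derivative (in the first variable) of a function on `ℝ × ℝ`. -/
noncomputable def pd1 (f : ℝ × ℝ → ℝ) (q : ℝ × ℝ) : ℝ :=
  deriv (fun s : ℝ => f (s, q.2)) q.1

/-- Second partial derivative (in the second variable) of a function on `ℝ × ℝ`. -/
noncomputable def pd2 (f : ℝ × ℝ → ℝ) (q : ℝ × ℝ) : ℝ :=
  deriv (fun t : ℝ => f (q.1, t)) q.2

theorem hasDerivAt_pd1 {f : ℝ × ℝ → ℝ} {q : ℝ × ℝ} (hf : DifferentiableAt ℝ f q) :
    HasDerivAt (fun s : ℝ => f (s, q.2)) (pd1 f q) q.1 :=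
  (DifferentiableAt.comp (f := fun s : ℝ => (s, q.2)) q.1 hf (by fun_prop)).hasDerivAt

theorem hasDerivAt_pd2 {f : ℝ × ℝ → ℝ} {q : ℝ × ℝ} (hf : DifferentiableAt ℝ f q) :
    HasDerivAt (fun t : ℝ => f (q.1, t)) (pd2 f q) q.2 :=
  (DifferentiableAt.comp (f := fun t : ℝ => (q.1, t)) q.2 hf (by fun_prop)).hasDerivAt

theorem pd1_eq_fderiv {f : ℝ × ℝ → ℝ} {q : ℝ × ℝ} (hf : DifferentiableAt ℝ f q) :
    pd1 f q = fderiv ℝ f q (1, 0) :=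
  (HasFDerivAt.comp_hasDerivAt (f := fun s : ℝ => (s, q.2)) q.1 hf.hasFDerivAt
    ((hasDerivAt_id q.1).prodMk (hasDerivAt_const q.1 q.2))).deriv

theorem pd2_eq_fderiv {f : ℝ × ℝ → ℝ} {q : ℝ × ℝ} (hf : DifferentiableAt ℝ f q) :
    pd2 f q = fderiv ℝ f q (0, 1) :=
  (HasFDerivAt.comp_hasDerivAt (f := fun t : ℝ => (q.1, t)) q.2 hf.hasFDerivAt
    ((hasDerivAt_const q.2 q.1).prodMk (hasDerivAt_id q.2))).deriv

theorem ContDiffAt.eventually_differentiableAt {f : ℝ × ℝ → ℝ} {q : ℝ × ℝ}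
    (hf : ContDiffAt ℝ 2 f q) : ∀ᶠ r in nhds q, DifferentiableAt ℝ f r :=
  (hf.eventually (by simp)).mono fun _ hr => hr.differentiableAt (by simp)

theorem ContDiffAt.differentiableAt_fderiv {f : ℝ × ℝ → ℝ} {q : ℝ × ℝ}
    (hf : ContDiffAt ℝ 2 f q) : DifferentiableAt ℝ (fderiv ℝ f) q :=
  (hf.fderiv_right (m := 1) (by norm_num)).differentiableAt (by simp)

theorem ContDiffAt.hasFDerivAt_pd1 {f : ℝ × ℝ → ℝ} {q : ℝ × ℝ} (hf : ContDiffAt ℝ 2 f q) :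
    HasFDerivAt (pd1 f) ((fderiv ℝ (fderiv ℝ f) q).flip (1, 0)) q := by
  have h := hf.differentiableAt_fderiv.hasFDerivAt.clm_apply
    (hasFDerivAt_const ((1, 0) : ℝ × ℝ) q)
  simp only [ContinuousLinearMap.comp_zero, zero_add] at h
  exact h.congr_of_eventuallyEq
    (hf.eventually_differentiableAt.mono fun _ hr => pd1_eq_fderiv hr)

theorem ContDiffAt.hasFDerivAt_pd2 {f : ℝ × ℝ → ℝ} {q : ℝ × ℝ} (hf : ContDiffAt ℝ 2 f q) :
    HasFDerivAt (pd2 f) ((fderiv ℝ (fderiv ℝ f) q).flip (0, 1)) q := by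
  have h := hf.differentiableAt_fderiv.hasFDerivAt.clm_apply
    (hasFDerivAt_const ((0, 1) : ℝ × ℝ) q)
  simp only [ContinuousLinearMap.comp_zero, zero_add] at h
  exact h.congr_of_eventuallyEq
    (hf.eventually_differentiableAt.mono fun _ hr => pd2_eq_fderiv hr)

/-- Mixed partial derivatives of a twice continuously differentiable function commute. -/
theorem ContDiffAt.pd1_pd2_comm {f : ℝ × ℝ → ℝ} {q : ℝ × ℝ} (hf : ContDiffAt ℝ 2 f q) :
    pd1 (pd2 f) q = pd2 (pd1 f) q := by
  rw [pd1_eq_fderiv hf.hasFDerivAt_pd2.differentiableAt,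
    pd2_eq_fderiv hf.hasFDerivAt_pd1.differentiableAt,
    hf.hasFDerivAt_pd2.fderiv, hf.hasFDerivAt_pd1.fderiv]
  exact (hf.isSymmSndFDerivAt (by simp)) (1, 0) (0, 1)

/-- The multiplier identity: for `u` twice continuously differentiable and a `C¹`
vector field `Z = (Z₁, Z₂)` on an open set `U ⊆ ℝ²` and a constant `H`, one has
`2(Z·∇u + Hu)Δu = 2 div((Z·∇u + Hu)∇u) + (Q∇u)·∇u − div(|∇u|² Z)` pointwise on `U`,
where `Qᵢⱼ = (div Z − 2H)δᵢⱼ − (∂ᵢZⱼ + ∂ⱼZᵢ)`. -/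
theorem multiplier_identity (U : Set (ℝ × ℝ)) (hU : IsOpen U)
    (u Z1 Z2 : ℝ × ℝ → ℝ) (H : ℝ)
    (hu : ContDiffOn ℝ 2 u U) (hZ1 : ContDiffOn ℝ 1 Z1 U) (hZ2 : ContDiffOn ℝ 1 Z2 U) :
    ∀ q ∈ U,
      2 * ((Z1 q * pd1 u q + Z2 q * pd2 u q + H * u q) * (pd1 (pd1 u) q + pd2 (pd2 u) q)) =
      2 * (pd1 (fun r => (Z1 r * pd1 u r + Z2 r * pd2 u r + H * u r) * pd1 u r) q
            + pd2 (fun r => (Z1 r * pd1 u r + Z2 r * pd2 u r + H * u r) * pd2 u r) q)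
      + ((pd1 Z1 q + pd2 Z2 q - 2 * H - 2 * pd1 Z1 q) * (pd1 u q) ^ 2
          + 2 * (-(pd1 Z2 q + pd2 Z1 q)) * (pd1 u q) * (pd2 u q)
          + (pd1 Z1 q + pd2 Z2 q - 2 * H - 2 * pd2 Z2 q) * (pd2 u q) ^ 2)
      - (pd1 (fun r => ((pd1 u r) ^ 2 + (pd2 u r) ^ 2) * Z1 r) q
            + pd2 (fun r => ((pd1 u r) ^ 2 + (pd2 u r) ^ 2) * Z2 r) q) := by
  intro q hq
  have hUq := hU.mem_nhds hq
  have hu2 := hu.contDiffAt hUq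
  have du := hu2.differentiableAt (by simp)
  have dZ1 := (hZ1.contDiffAt hUq).differentiableAt (by simp)
  have dZ2 := (hZ2.contDiffAt hUq).differentiableAt (by simp)
  have du1 := hu2.hasFDerivAt_pd1.differentiableAt
  have du2 := hu2.hasFDerivAt_pd2.differentiableAt
  have e1 : pd1 (fun r => (Z1 r * pd1 u r + Z2 r * pd2 u r + H * u r) * pd1 u r) q = _ :=
    (((((hasDerivAt_pd1 dZ1).mul (hasDerivAt_pd1 du1)).add
      ((hasDerivAt_pd1 dZ2).mul (hasDerivAt_pd1 du2))).add
      ((hasDerivAt_pd1 du).const_mul H)).mul (hasDerivAt_pd1 du1)).deriv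
  have e2 : pd2 (fun r => (Z1 r * pd1 u r + Z2 r * pd2 u r + H * u r) * pd2 u r) q = _ :=
    (((((hasDerivAt_pd2 dZ1).mul (hasDerivAt_pd2 du1)).add
      ((hasDerivAt_pd2 dZ2).mul (hasDerivAt_pd2 du2))).add
      ((hasDerivAt_pd2 du).const_mul H)).mul (hasDerivAt_pd2 du2)).deriv
  have e3 : pd1 (fun r => ((pd1 u r) ^ 2 + (pd2 u r) ^ 2) * Z1 r) q = _ :=
    ((((hasDerivAt_pd1 du1).pow 2).add ((hasDerivAt_pd1 du2).pow 2)).mul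
      (hasDerivAt_pd1 dZ1)).deriv
  have e4 : pd2 (fun r => ((pd1 u r) ^ 2 + (pd2 u r) ^ 2) * Z2 r) q = _ :=
    ((((hasDerivAt_pd2 du1).pow 2).add ((hasDerivAt_pd2 du2).pow 2)).mul
      (hasDerivAt_pd2 dZ2)).deriv
  rw [e1, e2, e3, e4, hu2.pd1_pd2_comm]
  simp only [Pi.add_apply, Pi.mul_apply, Pi.pow_apply, Prod.mk.eta]
  push_cast
  ring
end

section
/- Let Z : ℝ²∖{0} → ℝ² be Maz'ya's vector field Z(x₁,x₂) = ( x₁(x₁² − x₂²)/(x₁² + x₂²), 2x₁²x₂/(x₁² + x₂²) ), let H = 1/2, and define Q_{ij} = (∂₁Z₁ + ∂₂Z₂ − 2H)δ_{ij} − (∂_i Z_j + ∂_j Z_i). Then for every (x₁,x₂) ≠ (0,0) and every vector p = (p₁,p₂) ∈ ℝ², (Q p)·p = −2(2x₁x₂ p₁ + (x₂² − x₁²) p₂)² / (x₁² + x₂²)². In particular the quadratic form p ↦ (Qp)·p is negative semidefinite at every point of ℝ²∖{0}. -/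
open Set

/-- Maz'ya's vector field. -/
noncomputable def mazyaZ1 : ℝ × ℝ → ℝ := fun q => q.1 * (q.1 ^ 2 - q.2 ^ 2) / (q.1 ^ 2 + q.2 ^ 2)

noncomputable def mazyaZ2 : ℝ × ℝ → ℝ := fun q => 2 * q.1 ^ 2 * q.2 / (q.1 ^ 2 + q.2 ^ 2)

theorem pd1_mazyaZ1 {x y : ℝ} (h : x ^ 2 + y ^ 2 ≠ 0) :
    pd1 mazyaZ1 (x, y) = (x ^ 4 + 4 * x ^ 2 * y ^ 2 - y ^ 4) / (x ^ 2 + y ^ 2) ^ 2 := by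
  have hx := hasDerivAt_id' x
  refine (((hx.mul ((hx.pow 2).sub_const (y ^ 2))).div
    ((hx.pow 2).add_const (y ^ 2)) h).deriv).trans ?_
  simp
  ring

theorem pd2_mazyaZ1 {x y : ℝ} (h : x ^ 2 + y ^ 2 ≠ 0) :
    pd2 mazyaZ1 (x, y) = -4 * x ^ 3 * y / (x ^ 2 + y ^ 2) ^ 2 := by
  have hy := hasDerivAt_id' y
  refine (((((hy.pow 2).const_sub (x ^ 2)).const_mul x).div
    ((hy.pow 2).const_add (x ^ 2)) h).deriv).trans ?_
  simp
  ring

theorem pd1_mazyaZ2 {x y : ℝ} (h : x ^ 2 + y ^ 2 ≠ 0) :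
    pd1 mazyaZ2 (x, y) = 4 * x * y ^ 3 / (x ^ 2 + y ^ 2) ^ 2 := by
  have hx := hasDerivAt_id' x
  refine (((((hx.pow 2).const_mul 2).mul_const y).div
    ((hx.pow 2).add_const (y ^ 2)) h).deriv).trans ?_
  simp
  ring

theorem pd2_mazyaZ2 {x y : ℝ} (h : x ^ 2 + y ^ 2 ≠ 0) :
    pd2 mazyaZ2 (x, y) = 2 * x ^ 2 * (x ^ 2 - y ^ 2) / (x ^ 2 + y ^ 2) ^ 2 := by
  have hy := hasDerivAt_id' y
  refine (((hy.const_mul (2 * x ^ 2)).div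
    ((hy.pow 2).const_add (x ^ 2)) h).deriv).trans ?_
  simp
  ring

/-- For Maz'ya's field `Z(x₁,x₂) = (x₁(x₁²−x₂²)/(x₁²+x₂²), 2x₁²x₂/(x₁²+x₂²))` and `H = 1/2`,
with `Qᵢⱼ = (div Z − 2H)δᵢⱼ − (∂ᵢZⱼ + ∂ⱼZᵢ)`, one has for every point `≠ 0` and every
vector `p = (p₁,p₂)`:
`(Qp)·p = −2(2x₁x₂p₁ + (x₂²−x₁²)p₂)²/(x₁²+x₂²)²`, and in particular `(Qp)·p ≤ 0`. -/
theorem mazya_quadratic_form (x₁ x₂ : ℝ) (hx : (x₁, x₂) ≠ (0, 0)) (p₁ p₂ : ℝ) :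
    ((pd1 mazyaZ1 (x₁, x₂) + pd2 mazyaZ2 (x₁, x₂) - 2 * (1 / 2 : ℝ)
        - 2 * pd1 mazyaZ1 (x₁, x₂)) * p₁ ^ 2
      + 2 * (-(pd1 mazyaZ2 (x₁, x₂) + pd2 mazyaZ1 (x₁, x₂))) * p₁ * p₂
      + (pd1 mazyaZ1 (x₁, x₂) + pd2 mazyaZ2 (x₁, x₂) - 2 * (1 / 2 : ℝ)
        - 2 * pd2 mazyaZ2 (x₁, x₂)) * p₂ ^ 2
      = -2 * (2 * x₁ * x₂ * p₁ + (x₂ ^ 2 - x₁ ^ 2) * p₂) ^ 2 / (x₁ ^ 2 + x₂ ^ 2) ^ 2)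
    ∧ ((pd1 mazyaZ1 (x₁, x₂) + pd2 mazyaZ2 (x₁, x₂) - 2 * (1 / 2 : ℝ)
        - 2 * pd1 mazyaZ1 (x₁, x₂)) * p₁ ^ 2
      + 2 * (-(pd1 mazyaZ2 (x₁, x₂) + pd2 mazyaZ1 (x₁, x₂))) * p₁ * p₂
      + (pd1 mazyaZ1 (x₁, x₂) + pd2 mazyaZ2 (x₁, x₂) - 2 * (1 / 2 : ℝ)
        - 2 * pd2 mazyaZ2 (x₁, x₂)) * p₂ ^ 2 ≤ 0) := by
  have h : x₁ ^ 2 + x₂ ^ 2 ≠ 0 := by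
    intro h
    exact hx (Prod.ext (by simp; nlinarith) (by simp; nlinarith))
  simp only [pd1_mazyaZ1 h, pd2_mazyaZ1 h, pd1_mazyaZ2 h, pd2_mazyaZ2 h]
  refine (and_iff_left_of_imp fun heq => ?_).2 ?_
  · rw [heq, neg_mul, neg_div]
    exact neg_nonpos.2 (by positivity)
  · field_simp
    ring
end

section
/- Let ν > 0 and let w : [0,∞) → ℂ be continuously differentiable with ∫₀^∞ |w′(t)|² dt < ∞, with w(t)e^{−νt} → 0 as t → ∞, and such that t ↦ w(t)e^{−νt} is integrable on (0,∞) with ∫₀^∞ w(t)e^{−νt} dt = 0. Then 2ν|w(0)|² ≤ ∫₀^∞ |w′(t)|² dt. -/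
open Set MeasureTheory Filter

/-- Trace estimate on the half-line: if `w` is `C¹` on `[0,∞)` with `w' ∈ L²(0,∞)`,
`w(t)e^{−νt} → 0` as `t → ∞`, and `t ↦ w(t)e^{−νt}` is integrable on `(0,∞)` with
`∫₀^∞ w(t)e^{−νt} dt = 0`, then `2ν|w(0)|² ≤ ∫₀^∞ |w′(t)|² dt`. -/
theorem trace_estimate_halfline (ν : ℝ) (hν : 0 < ν) (w : ℝ → ℂ)
    (hw : ContDiffOn ℝ 1 w (Ici (0 : ℝ)))
    (hw' : IntegrableOn (fun t => ‖derivWithin w (Ici (0 : ℝ)) t‖ ^ 2) (Ioi (0 : ℝ)))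
    (hlim : Tendsto (fun t : ℝ => w t * Complex.exp (-(ν : ℂ) * t)) atTop (nhds 0))
    (hint : IntegrableOn (fun t : ℝ => w t * Complex.exp (-(ν : ℂ) * t)) (Ioi (0 : ℝ)))
    (hzero : ∫ t in Ioi (0 : ℝ), w t * Complex.exp (-(ν : ℂ) * t) = 0) :
    2 * ν * ‖w 0‖ ^ 2 ≤ ∫ t in Ioi (0 : ℝ), ‖derivWithin w (Ici (0 : ℝ)) t‖ ^ 2 := by
  set g := derivWithin w (Ici (0 : ℝ))
  have hgc : ContinuousOn g (Ici 0) := hw.continuousOn_derivWithin (uniqueDiffOn_Ici 0) le_rfl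
  have hwd : ∀ x ∈ Ioi (0 : ℝ), HasDerivAt w (g x) x := fun x hx =>
    ((hw.differentiableOn one_ne_zero x (Ioi_subset_Ici_self hx)).hasDerivWithinAt).hasDerivAt
      (Ici_mem_nhds hx)
  have hexp : ∀ x : ℝ, HasDerivAt (fun t : ℝ => Complex.exp (-(ν : ℂ) * t))
      (Complex.exp (-(ν : ℂ) * x) * (-(ν : ℂ))) x := fun x => by
    simpa using ((Complex.ofRealCLM.hasDerivAt (x := x)).const_mul (-(ν : ℂ))).cexp
  have hec : Continuous fun t : ℝ => Complex.exp (-(ν : ℂ) * t) := by fun_prop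
  have hnorm : ∀ t : ℝ, ‖Complex.exp (-(ν : ℂ) * t)‖ = Real.exp (-ν * t) := fun t => by
    simp [Complex.norm_exp]
  have hsq : ∀ t : ℝ, Real.exp (-(2 * ν) * t) = Real.exp (-ν * t) ^ 2 := fun t => by
    rw [← Real.exp_nat_mul]; congr 1; push_cast; ring
  have hE : IntegrableOn (fun t : ℝ => Real.exp (-ν * t) ^ 2) (Ioi 0) := by
    simpa only [hsq] using integrableOn_exp_mul_Ioi (a := -(2 * ν)) (by linarith) 0
  have hEv : ∫ t in Ioi (0 : ℝ), Real.exp (-ν * t) ^ 2 = 1 / (2 * ν) := by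
    simp_rw [← hsq]
    rw [integral_exp_mul_Ioi (by linarith) 0, mul_zero, Real.exp_zero, neg_div_neg_eq]
  have hge : IntegrableOn (fun t : ℝ => g t * Complex.exp (-(ν : ℂ) * t)) (Ioi 0) := by
    refine (hw'.add hE).mono'
      (((hgc.mono Ioi_subset_Ici_self).mul hec.continuousOn).aestronglyMeasurable
        measurableSet_Ioi) (ae_of_all _ fun t => ?_)
    simp only [norm_mul, hnorm, Pi.add_apply]
    nlinarith [sq_nonneg (‖g t‖ - Real.exp (-ν * t)), sq_nonneg ‖g t‖,
      sq_nonneg (Real.exp (-ν * t))]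
  have hparts : ∫ t in Ioi (0 : ℝ), g t * Complex.exp (-(ν : ℂ) * t) = -w 0 := by
    have hftc := integral_Ioi_of_hasDerivAt_of_tendsto
      (f := fun t : ℝ => w t * Complex.exp (-(ν : ℂ) * t))
      (f' := fun t : ℝ => g t * Complex.exp (-(ν : ℂ) * t)
        + (-(ν : ℂ)) * (w t * Complex.exp (-(ν : ℂ) * t)))
      ((hw.continuousOn 0 self_mem_Ici).mul hec.continuousWithinAt)
      (fun x hx => ((hwd x hx).mul (hexp x)).congr_deriv (by ring))
      (hge.add (hint.const_mul _)) hlim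
    rw [integral_add hge (hint.const_mul _), integral_const_mul, hzero] at hftc
    simpa using hftc
  have hbound : ‖w 0‖ ≤ ∫ t in Ioi (0 : ℝ), ‖g t‖ * Real.exp (-ν * t) := by
    rw [← norm_neg, ← hparts]
    refine (norm_integral_le_integral_norm _).trans_eq ?_
    simp only [norm_mul, hnorm]
  have hprod : IntegrableOn (fun t : ℝ => ‖g t‖ * Real.exp (-ν * t)) (Ioi 0) := by
    simpa only [IntegrableOn, norm_mul, hnorm] using hge.norm
  have hyoung := integral_mono (hprod.const_mul (2 * (2 * ν * ‖w 0‖)))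
    (hw'.add (hE.const_mul ((2 * ν * ‖w 0‖) ^ 2))) fun t => by
      simp only [Pi.add_apply]
      nlinarith [sq_nonneg (‖g t‖ - 2 * ν * ‖w 0‖ * Real.exp (-ν * t))]
  simp only [Pi.add_apply] at hyoung
  rw [integral_const_mul, integral_add hw' (hE.const_mul _), integral_const_mul, hEv] at hyoung
  have hconst : (2 * ν * ‖w 0‖) ^ 2 * (1 / (2 * ν)) = 2 * ν * ‖w 0‖ ^ 2 := by
    field_simp
  have hmul := mul_le_mul_of_nonneg_left hbound
    (show 0 ≤ 2 * (2 * ν * ‖w 0‖) by positivity)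
  linarith [show 2 * (2 * ν * ‖w 0‖) * ‖w 0‖ = 4 * ν * ‖w 0‖ ^ 2 by ring]
end

section
/- Let ν > 0 and ε ∈ ℝ with |ε| < 1, and set ⟨t⟩ = (1+t²)^{1/2}. Let u : ℝ → ℂ be twice continuously differentiable and suppose there is δ > |ε|/(2ν) with ∫_ℝ e^{2δ⟨t⟩}(|u(t)|² + |u′(t)|² + |u″(t)|²) dt < ∞. Set f(t) = u″(t) + (ν² − iε)u(t). Then there is an absolute constant c, independent of ν, ε, u, f, such that (ν/(1+ν²))·‖u″‖_{L²(ℝ)} + ‖u′‖_{L²(ℝ)} + ν·‖u‖_{L²(ℝ)} ≤ c ( ∫_ℝ |f(t)|² ⟨t⟩² e^{(|ε|/ν)⟨t⟩} dt )^{1/2}. -/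
open MeasureTheory Real

lemma abs_le_sqrt_one_add_sq (t : ℝ) : |t| ≤ √(1 + t ^ 2) :=
  Real.abs_le_sqrt (by linarith)

lemma one_le_sqrt_one_add_sq (t : ℝ) : 1 ≤ √(1 + t ^ 2) :=
  Real.one_le_sqrt.2 (by nlinarith [sq_nonneg t])

lemma hasDerivAt_sqrt_one_add_sq (t : ℝ) :
    HasDerivAt (fun t : ℝ => √(1 + t ^ 2)) (t / √(1 + t ^ 2)) t := by
  have h := ((hasDerivAt_pow 2 t).const_add 1).sqrt (by positivity)
  refine h.congr_deriv ?_
  push_cast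
  field_simp

lemma neg_half_le_sq_div_sub_abs (t : ℝ) :
    -(1 / 2) ≤ t ^ 2 / √(1 + t ^ 2) - |t| := by
  have h1 := one_le_sqrt_one_add_sq t
  have h2 := abs_le_sqrt_one_add_sq t
  have h3 : √(1 + t ^ 2) ^ 2 = 1 + t ^ 2 := Real.sq_sqrt (by positivity)
  have h4 := sq_abs t
  have h5 := abs_nonneg t
  set s := √(1 + t ^ 2)
  have hs : 0 < s := by linarith
  rw [le_sub_iff_add_le, le_div_iff₀ hs]
  nlinarith [sq_nonneg (s - |t|), mul_nonneg (sub_nonneg.2 h2) (sub_nonneg.2 h1)]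

/-- Weighted Hardy inequality for the first-order equation `v′ + μv = f`. -/
lemma integral_norm_sq_le_of_hasDerivAt {μ : ℂ} (hμ : |μ.re| ≤ 1) {v f : ℝ → ℂ}
    (hv : ∀ t, HasDerivAt v (f t - μ * v t) t) (hf : Continuous f)
    (hvi : Integrable fun t : ℝ =>
      ‖v t‖ ^ 2 * (1 + t ^ 2) * Real.exp (2 * |μ.re| * √(1 + t ^ 2)))
    (hfi : Integrable fun t : ℝ =>
      ‖f t‖ ^ 2 * (1 + t ^ 2) * Real.exp (2 * |μ.re| * √(1 + t ^ 2))) :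
    ∫ t, ‖v t‖ ^ 2 ≤
      16 * ∫ t : ℝ, ‖f t‖ ^ 2 * (1 + t ^ 2) * Real.exp (2 * |μ.re| * √(1 + t ^ 2)) := by
  have hvc : Continuous v := continuous_iff_continuousAt.2 fun t => (hv t).continuousAt
  have hs0 : ∀ t : ℝ, √(1 + t ^ 2) ≠ 0 := fun t => by positivity
  set a := μ.re
  set s : ℝ → ℝ := fun t => √(1 + t ^ 2)
  have hsc : Continuous s := by fun_prop
  set w : ℝ → ℝ := fun t => Real.exp (a * t + |a| * s t)
  have hwc : Continuous w := by fun_prop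
  have hw1 : ∀ t, 1 ≤ w t := fun t => by
    refine Real.one_le_exp ?_
    have h1 := neg_abs_le (a * t)
    rw [abs_mul] at h1
    nlinarith [abs_nonneg a, abs_le_sqrt_one_add_sq t]
  have hw2 : ∀ t, w t ≤ Real.exp (2 * |a| * s t) := fun t => by
    refine Real.exp_le_exp.2 ?_
    have h1 := le_abs_self (a * t)
    rw [abs_mul] at h1
    nlinarith [abs_nonneg a, abs_le_sqrt_one_add_sq t]
  set p : ℝ → ℝ := fun t => t * w t * ‖v t‖ ^ 2
  set D : ℝ → ℝ := fun t => w t * (1 + |a| * (t ^ 2 / s t) - a * t) * ‖v t‖ ^ 2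
    + 2 * t * w t * inner ℝ (v t) (f t) with hD
  have hpD : ∀ t, HasDerivAt p (D t) t := fun t => by
    have hwd : HasDerivAt w (w t * (a + |a| * (t / s t))) t := by
      have := (((hasDerivAt_id t).const_mul a).add
        ((hasDerivAt_sqrt_one_add_sq t).const_mul |a|)).exp
      simpa using this
    have h := ((hasDerivAt_id t).mul hwd).mul (hv t).norm_sq
    refine h.congr_deriv ?_
    have h1 : inner ℝ (v t) (f t - μ * v t) = inner ℝ (v t) (f t) - a * ‖v t‖ ^ 2 := by
      rw [inner_sub_right]
      congr 1
      rw [Complex.inner, ← Complex.normSq_eq_norm_sq, Complex.normSq_apply]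
      simp [a]
      ring
    rw [h1]
    simp only [hD, id, Pi.mul_apply]
    ring
  have hpc : Continuous p := by fun_prop
  have hDc : Continuous D := by
    have : Continuous fun t => t ^ 2 / s t := (continuous_pow 2).div hsc hs0
    have : Continuous fun t => inner ℝ (v t) (f t) := hvc.inner hf
    fun_prop
  have hinner : ∀ t, |2 * t * w t * inner ℝ (v t) (f t)| ≤ w t * (2 * |t| * ‖v t‖ * ‖f t‖) := by
    intro t
    have h := abs_real_inner_le_norm (v t) (f t)
    have h0 : 0 ≤ w t := (Real.exp_pos _).le
    rw [abs_mul, abs_mul, abs_mul, abs_two, abs_of_nonneg h0]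
    calc 2 * |t| * w t * |inner ℝ (v t) (f t)| ≤ 2 * |t| * w t * (‖v t‖ * ‖f t‖) := by gcongr
      _ = _ := by ring
  have hpi : Integrable p := by
    refine hvi.mono' hpc.aestronglyMeasurable (.of_forall fun t => ?_)
    have h0 : 0 ≤ w t := (Real.exp_pos _).le
    rw [Real.norm_eq_abs, abs_mul, abs_mul, abs_of_nonneg h0, abs_of_nonneg (sq_nonneg ‖v t‖)]
    have ht : |t| ≤ 1 + t ^ 2 := by nlinarith [sq_nonneg (|t| - 1), sq_abs t]
    calc |t| * w t * ‖v t‖ ^ 2 ≤ (1 + t ^ 2) * Real.exp (2 * |a| * s t) * ‖v t‖ ^ 2 := by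
          gcongr; exact hw2 t
      _ = _ := by ring
  have hDi : Integrable D := by
    refine ((hvi.const_mul 3).add hfi).mono' hDc.aestronglyMeasurable (.of_forall fun t => ?_)
    have h0 : 0 ≤ w t := (Real.exp_pos _).le
    have hst := abs_le_sqrt_one_add_sq t
    have hs1 := one_le_sqrt_one_add_sq t
    have hq : |1 + |a| * (t ^ 2 / s t) - a * t| ≤ 2 * (1 + t ^ 2) := by
      have h1 : t ^ 2 / s t ≤ |t| := by
        rw [div_le_iff₀ (by positivity), ← sq_abs]
        nlinarith [abs_nonneg t]
      have h2 : 0 ≤ t ^ 2 / s t := by positivity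
      have h3 : |a * t| ≤ |t| := by
        rw [abs_mul]; exact mul_le_of_le_one_left (abs_nonneg t) hμ
      have h4 : |a| * (t ^ 2 / s t) ≤ t ^ 2 / s t := mul_le_of_le_one_left h2 hμ
      have h5 := abs_le.1 h3
      have h6 : 0 ≤ |a| * (t ^ 2 / s t) := by positivity
      rw [abs_le]
      constructor <;> nlinarith [sq_nonneg (|t| - 1), sq_abs t]
    have hvf : 2 * |t| * ‖v t‖ * ‖f t‖ ≤ (1 + t ^ 2) * (‖v t‖ ^ 2 + ‖f t‖ ^ 2) := by
      have h1 : |t| ≤ 1 + t ^ 2 := by nlinarith [sq_nonneg (|t| - 1), sq_abs t]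
      calc 2 * |t| * ‖v t‖ * ‖f t‖ = |t| * (2 * ‖v t‖ * ‖f t‖) := by ring
        _ ≤ (1 + t ^ 2) * (‖v t‖ ^ 2 + ‖f t‖ ^ 2) := by
          gcongr
          exact two_mul_le_add_sq _ _
    calc ‖D t‖ ≤ |w t * (1 + |a| * (t ^ 2 / s t) - a * t) * ‖v t‖ ^ 2|
          + |2 * t * w t * inner ℝ (v t) (f t)| := abs_add_le _ _
      _ ≤ w t * (2 * (1 + t ^ 2)) * ‖v t‖ ^ 2
          + w t * ((1 + t ^ 2) * (‖v t‖ ^ 2 + ‖f t‖ ^ 2)) := by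
        refine add_le_add ?_ ((hinner t).trans (by gcongr))
        rw [abs_mul, abs_mul, abs_of_nonneg h0, abs_of_nonneg (sq_nonneg ‖v t‖)]
        gcongr
      _ = w t * ((1 + t ^ 2) * (3 * ‖v t‖ ^ 2 + ‖f t‖ ^ 2)) := by ring
      _ ≤ Real.exp (2 * |a| * s t) * ((1 + t ^ 2) * (3 * ‖v t‖ ^ 2 + ‖f t‖ ^ 2)) := by
        gcongr; exact hw2 t
      _ = _ := by simp only [Pi.add_apply]; ring
  have hD0 : ∫ t, D t = 0 := integral_eq_zero_of_hasDerivAt_of_integrable hpD hDi hpi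
  have hpt : ∀ t, ‖v t‖ ^ 2 ≤
      4 * D t + 16 * (‖f t‖ ^ 2 * (1 + t ^ 2) * Real.exp (2 * |a| * s t)) := fun t => by
    have h0 : 0 ≤ w t := (Real.exp_pos _).le
    have hq : 1 / 2 ≤ 1 + |a| * (t ^ 2 / s t) - a * t := by
      have h1 := neg_half_le_sq_div_sub_abs t
      have h2 := le_abs_self (a * t)
      rw [abs_mul] at h2
      have h3 : |a| * (-(1 / 2)) ≤ |a| * (t ^ 2 / s t - |t|) := by gcongr
      linarith
    have h1 := neg_abs_le (2 * t * w t * inner ℝ (v t) (f t))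
    have h2 := hinner t
    have h3 : w t * (1 / 2) * ‖v t‖ ^ 2 ≤
        w t * (1 + |a| * (t ^ 2 / s t) - a * t) * ‖v t‖ ^ 2 := by gcongr
    have h4 : w t * (2 * |t| * ‖v t‖ * ‖f t‖) ≤
        w t * (‖v t‖ ^ 2 / 4 + 4 * (‖f t‖ ^ 2 * t ^ 2)) := by
      gcongr
      nlinarith [sq_nonneg (‖v t‖ / 2 - 2 * (‖f t‖ * |t|)), sq_abs t]
    have h5 : 1 * ‖v t‖ ^ 2 ≤ w t * ‖v t‖ ^ 2 := by gcongr; exact hw1 t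
    have h6 : w t * (‖f t‖ ^ 2 * t ^ 2) ≤
        Real.exp (2 * |a| * s t) * (‖f t‖ ^ 2 * (1 + t ^ 2)) := by
      gcongr
      · exact hw2 t
      · linarith
    simp only [hD]
    linarith
  calc ∫ t, ‖v t‖ ^ 2
      ≤ ∫ t, (4 * D t + 16 * (‖f t‖ ^ 2 * (1 + t ^ 2) * Real.exp (2 * |a| * s t))) :=
        integral_mono_of_nonneg (.of_forall fun t => by positivity)
          ((hDi.const_mul 4).add (hfi.const_mul 16)) (.of_forall hpt)
    _ = _ := by
      rw [integral_add (hDi.const_mul 4) (hfi.const_mul 16), integral_const_mul,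
        integral_const_mul, hD0]
      ring

lemma integrable_of_norm_le_weight {γ δ K : ℝ} (hγδ : γ < δ) {E h : ℝ → ℝ}
    (hEi : Integrable fun t : ℝ => Real.exp (δ * √(1 + t ^ 2)) * E t) (hh : Continuous h)
    (hK : ∀ t, ‖h t‖ ≤ K * E t) :
    Integrable fun t : ℝ => h t * (1 + t ^ 2) * Real.exp (γ * √(1 + t ^ 2)) := by
  have hκ : 0 < δ - γ := sub_pos.2 hγδ
  refine (hEi.const_mul (K * (2 / (δ - γ) ^ 2))).mono' (by fun_prop) (.of_forall fun t => ?_)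
  have hs : √(1 + t ^ 2) ^ 2 = 1 + t ^ 2 := Real.sq_sqrt (by positivity)
  set s := √(1 + t ^ 2)
  have hs0 : 0 ≤ s := Real.sqrt_nonneg _
  have hx : 0 ≤ (δ - γ) * s := by positivity
  have h1 : 1 + t ^ 2 ≤ 2 / (δ - γ) ^ 2 * Real.exp ((δ - γ) * s) := by
    rw [div_mul_eq_mul_div, le_div_iff₀ (by positivity), ← hs]
    nlinarith [Real.quadratic_le_exp_of_nonneg hx]
  have h2 : Real.exp (δ * s) = Real.exp ((δ - γ) * s) * Real.exp (γ * s) := by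
    rw [← Real.exp_add]; ring_nf
  have h3 : 0 ≤ K * E t := (norm_nonneg _).trans (hK t)
  rw [norm_mul, norm_mul, Real.norm_of_nonneg (Real.exp_pos _).le,
    Real.norm_of_nonneg (by positivity : 0 ≤ 1 + t ^ 2)]
  calc ‖h t‖ * (1 + t ^ 2) * Real.exp (γ * s)
      ≤ (K * E t) * (2 / (δ - γ) ^ 2 * Real.exp ((δ - γ) * s)) * Real.exp (γ * s) := by
        gcongr
        exact hK t
    _ = _ := by rw [h2]; ring

lemma integrable_of_integrable_weight {γ : ℝ} (hγ : 0 ≤ γ) {h : ℝ → ℝ} (hh : Continuous h)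
    (hi : Integrable fun t : ℝ => h t * (1 + t ^ 2) * Real.exp (γ * √(1 + t ^ 2))) :
    Integrable h := by
  refine hi.mono hh.aestronglyMeasurable (.of_forall fun t => ?_)
  rw [norm_mul, norm_mul, mul_assoc]
  refine le_mul_of_one_le_right (norm_nonneg _) ?_
  have h1 : 1 ≤ 1 + t ^ 2 := by nlinarith [sq_nonneg t]
  have h2 : 1 ≤ Real.exp (γ * √(1 + t ^ 2)) := Real.one_le_exp (by positivity)
  rw [Real.norm_of_nonneg (by positivity), Real.norm_of_nonneg (by positivity)]
  nlinarith

lemma exists_characteristic_root {ν ε : ℝ} (hν : 0 < ν) (hε : |ε| < 1) :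
    ∃ μ : ℂ, μ ^ 2 = Complex.I * ε - (ν : ℂ) ^ 2 ∧ |μ.re| ≤ 1 ∧ 2 * |μ.re| ≤ |ε| / ν ∧
      ν ^ 2 ≤ ‖μ‖ ^ 2 ∧ ‖μ‖ ^ 2 ≤ 1 + ν ^ 2 := by
  obtain ⟨μ, hμ⟩ := IsAlgClosed.exists_pow_nat_eq (Complex.I * ε - (ν : ℂ) ^ 2) two_pos
  have hre : μ.re ^ 2 - μ.im ^ 2 = -ν ^ 2 := by
    have := congrArg Complex.re hμ
    simp [pow_two] at this
    nlinarith
  have him : 2 * (μ.re * μ.im) = ε := by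
    have := congrArg Complex.im hμ
    simp [pow_two] at this
    linarith
  have hn : ‖μ‖ ^ 2 = μ.re ^ 2 + μ.im ^ 2 := by
    rw [← Complex.normSq_eq_norm_sq, Complex.normSq_apply]; ring
  have hε2 : |μ.re| * |μ.im| * 2 = |ε| := by
    rw [← him, abs_mul, abs_mul, abs_two]; ring
  rw [← sq_abs μ.re, ← sq_abs μ.im] at hre hn
  have hx := abs_nonneg μ.re
  have hy := abs_nonneg μ.im
  set x := |μ.re|
  set y := |μ.im|
  have hyν : ν ≤ y := by nlinarith
  have hxy : x ≤ y := by nlinarith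
  refine ⟨μ, hμ, by nlinarith, ?_, by rw [hn]; nlinarith, by rw [hn]; nlinarith⟩
  rw [le_div_iff₀ hν]
  nlinarith

lemma sq_norm_add_le (a b : ℂ) : ‖a + b‖ ^ 2 ≤ 2 * (‖a‖ ^ 2 + ‖b‖ ^ 2) := by
  have h := norm_add_le a b
  nlinarith [norm_nonneg (a + b), sq_nonneg (‖a‖ - ‖b‖)]

/-- A priori estimate for the 1-D Schrödinger equation `u″ + (ν² − iε)u = f` with
absorption: there is an absolute constant `c`, independent of `ν, ε, u, f`, such that
for all `ν > 0`, `|ε| < 1` and `u` twice continuously differentiable with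
`∫ e^{2δ⟨t⟩}(|u|² + |u′|² + |u″|²) < ∞` for some `δ > |ε|/(2ν)`, one has
`(ν/(1+ν²))‖u″‖_{L²} + ‖u′‖_{L²} + ν‖u‖_{L²} ≤ c (∫ |f|²⟨t⟩²e^{(|ε|/ν)⟨t⟩})^{1/2}`. -/
theorem schrodinger_absorption_estimate :
    ∃ c : ℝ, 0 < c ∧ ∀ (ν ε : ℝ) (u : ℝ → ℂ),
      0 < ν → |ε| < 1 → ContDiff ℝ 2 u →
      (∃ δ : ℝ, |ε| / (2 * ν) < δ ∧
        Integrable (fun t : ℝ => Real.exp (2 * δ * Real.sqrt (1 + t ^ 2)) *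
          (‖u t‖ ^ 2 + ‖deriv u t‖ ^ 2 + ‖deriv (deriv u) t‖ ^ 2))) →
      ν / (1 + ν ^ 2) * Real.sqrt (∫ t : ℝ, ‖deriv (deriv u) t‖ ^ 2)
        + Real.sqrt (∫ t : ℝ, ‖deriv u t‖ ^ 2)
        + ν * Real.sqrt (∫ t : ℝ, ‖u t‖ ^ 2) ≤
      c * Real.sqrt (∫ t : ℝ,
          ‖deriv (deriv u) t + ((ν : ℂ) ^ 2 - Complex.I * ε) * u t‖ ^ 2 *
            (1 + t ^ 2) * Real.exp (|ε| / ν * Real.sqrt (1 + t ^ 2))) := by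
  refine ⟨14, by norm_num, fun ν ε u hν hε hu ⟨δ, hδ, hi⟩ => ?_⟩
  obtain ⟨μ, hμ, hμ1, hμε, hνμ, hμν⟩ := exists_characteristic_root hν hε
  rw [← one_add_one_eq_two] at hu
  obtain ⟨hu0, -, hu'⟩ := contDiff_succ_iff_deriv.1 hu
  obtain ⟨hu1, hu''⟩ := contDiff_one_iff_deriv.1 hu'
  have hc0 := hu0.continuous
  have hc1 := hu1.continuous
  have hcoef : (ν : ℂ) ^ 2 - Complex.I * ε = -μ ^ 2 := by rw [hμ]; ring
  simp only [hcoef]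
  set f : ℝ → ℂ := fun t => deriv (deriv u) t + -μ ^ 2 * u t with hf
  have hfc : Continuous f := by fun_prop
  have hγ : |ε| / ν < 2 * δ := by
    have : |ε| / ν = 2 * (|ε| / (2 * ν)) := by field_simp
    linarith
  have hfi : Integrable fun t : ℝ =>
      ‖f t‖ ^ 2 * (1 + t ^ 2) * Real.exp (|ε| / ν * √(1 + t ^ 2)) := by
    refine integrable_of_norm_le_weight (K := 2 * (1 + ‖μ‖ ^ 4)) hγ hi (by fun_prop) fun t => ?_
    have h := sq_norm_add_le (deriv (deriv u) t) (-μ ^ 2 * u t)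
    rw [norm_mul, norm_neg, norm_pow] at h
    rw [Real.norm_of_nonneg (by positivity)]
    refine h.trans ?_
    have : 0 ≤ ‖μ‖ ^ 4 * (‖deriv u t‖ ^ 2 + ‖deriv (deriv u) t‖ ^ 2) := by positivity
    nlinarith [sq_nonneg ‖u t‖, sq_nonneg ‖deriv u t‖]
  have hui : Integrable fun t => ‖u t‖ ^ 2 :=
    integrable_of_integrable_weight (by positivity) (by fun_prop)
      (integrable_of_norm_le_weight (K := 1) hγ hi (by fun_prop) fun t => by
        rw [Real.norm_of_nonneg (by positivity)]
        nlinarith [sq_nonneg ‖deriv u t‖, sq_nonneg ‖deriv (deriv u) t‖])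
  have hu'i : Integrable fun t => ‖deriv u t‖ ^ 2 :=
    integrable_of_integrable_weight (by positivity) (by fun_prop)
      (integrable_of_norm_le_weight (K := 1) hγ hi (by fun_prop) fun t => by
        rw [Real.norm_of_nonneg (by positivity)]
        nlinarith [sq_nonneg ‖u t‖, sq_nonneg ‖deriv (deriv u) t‖])
  have hf0i : Integrable fun t => ‖f t‖ ^ 2 :=
    integrable_of_integrable_weight (by positivity) (by fun_prop) hfi
  set I := ∫ t : ℝ, ‖f t‖ ^ 2 * (1 + t ^ 2) * Real.exp (|ε| / ν * √(1 + t ^ 2))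
  have hI0 : 0 ≤ I := integral_nonneg fun t => by positivity
  have hfactor : ∀ κ : ℂ, κ ^ 2 = μ ^ 2 → |κ.re| = |μ.re| →
      Integrable (fun t => ‖deriv u t - κ * u t‖ ^ 2) ∧
        ∫ t, ‖deriv u t - κ * u t‖ ^ 2 ≤ 16 * I := by
    intro κ hκ hre
    have hκε : 2 * |κ.re| ≤ |ε| / ν := hre ▸ hμε
    have hwt : ∀ {γ : ℝ}, γ < 2 * δ → Integrable fun t : ℝ =>
        ‖deriv u t - κ * u t‖ ^ 2 * (1 + t ^ 2) * Real.exp (γ * √(1 + t ^ 2)) := by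
      intro γ hγ
      refine integrable_of_norm_le_weight (K := 2 * (1 + ‖κ‖ ^ 2)) hγ hi (by fun_prop)
        fun t => ?_
      have h := sq_norm_add_le (deriv u t) (-(κ * u t))
      rw [norm_neg, norm_mul, ← sub_eq_add_neg] at h
      rw [Real.norm_of_nonneg (by positivity)]
      refine h.trans ?_
      have : 0 ≤ ‖κ‖ ^ 2 * (‖deriv u t‖ ^ 2 + ‖deriv (deriv u) t‖ ^ 2) := by positivity
      nlinarith [sq_nonneg ‖u t‖, sq_nonneg ‖deriv (deriv u) t‖]
    have hle : ∀ t, ‖f t‖ ^ 2 * (1 + t ^ 2) * Real.exp (2 * |κ.re| * √(1 + t ^ 2)) ≤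
        ‖f t‖ ^ 2 * (1 + t ^ 2) * Real.exp (|ε| / ν * √(1 + t ^ 2)) := fun t => by gcongr
    have hfκ : Integrable fun t : ℝ =>
        ‖f t‖ ^ 2 * (1 + t ^ 2) * Real.exp (2 * |κ.re| * √(1 + t ^ 2)) :=
      hfi.mono' (by fun_prop) (.of_forall fun t => by
        rw [Real.norm_of_nonneg (by positivity)]; exact hle t)
    refine ⟨integrable_of_integrable_weight (γ := |ε| / ν) (by positivity) (by fun_prop) (hwt hγ),
      ?_⟩
    refine (integral_norm_sq_le_of_hasDerivAt (f := f) (hre ▸ hμ1) (fun t => ?_) hfc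
      (hwt (hκε.trans_lt hγ)) hfκ).trans ?_
    · refine ((hu1 t).hasDerivAt.sub ((hu0 t).hasDerivAt.const_mul κ)).congr_deriv ?_
      simp only [hf, ← hκ]
      ring
    · exact mul_le_mul_of_nonneg_left (integral_mono hfκ hfi hle) (by norm_num)
  obtain ⟨hi₁, hb₁⟩ := hfactor μ rfl rfl
  obtain ⟨hi₂, hb₂⟩ := hfactor (-μ) (by ring) (by simp)
  have hpar : (∫ t, ‖deriv u t‖ ^ 2) + ‖μ‖ ^ 2 * ∫ t, ‖u t‖ ^ 2 ≤ 16 * I := by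
    have h : ∀ t, ‖deriv u t - μ * u t‖ ^ 2 + ‖deriv u t - -μ * u t‖ ^ 2 =
        2 * (‖deriv u t‖ ^ 2 + ‖μ‖ ^ 2 * ‖u t‖ ^ 2) := fun t => by
      have := parallelogram_law_with_norm ℝ (deriv u t) (μ * u t)
      rw [norm_mul] at this
      rw [neg_mul, sub_neg_eq_add]
      linarith
    have h2 := integral_add hi₁ hi₂
    simp only [h] at h2
    rw [integral_const_mul, integral_add hu'i (hui.const_mul _), integral_const_mul] at h2
    linarith
  set A := ∫ t, ‖u t‖ ^ 2
  set B := ∫ t, ‖deriv u t‖ ^ 2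
  have hA0 : 0 ≤ A := integral_nonneg fun t => by positivity
  have hB0 : 0 ≤ B := integral_nonneg fun t => by positivity
  have hC : ∫ t, ‖deriv (deriv u) t‖ ^ 2 ≤ 2 * (I + ‖μ‖ ^ 4 * A) := by
    have hfI : ∫ t, ‖f t‖ ^ 2 ≤ I := by
      refine integral_mono hf0i hfi fun t => ?_
      have h1 : 1 ≤ 1 + t ^ 2 := by nlinarith [sq_nonneg t]
      have h2 : 1 ≤ Real.exp (|ε| / ν * √(1 + t ^ 2)) := Real.one_le_exp (by positivity)
      show ‖f t‖ ^ 2 ≤ _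
      rw [mul_assoc]
      exact le_mul_of_one_le_right (by positivity) (by nlinarith)
    have h : ∀ t, ‖deriv (deriv u) t‖ ^ 2 ≤ 2 * (‖f t‖ ^ 2 + ‖μ‖ ^ 4 * ‖u t‖ ^ 2) := fun t => by
      have h := sq_norm_add_le (f t) (μ ^ 2 * u t)
      rw [norm_mul, norm_pow] at h
      have h2 : f t + μ ^ 2 * u t = deriv (deriv u) t := by simp only [hf]; ring
      rw [h2] at h
      linarith
    calc ∫ t, ‖deriv (deriv u) t‖ ^ 2 ≤ ∫ t, 2 * (‖f t‖ ^ 2 + ‖μ‖ ^ 4 * ‖u t‖ ^ 2) :=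
          integral_mono_of_nonneg (.of_forall fun t => by positivity)
            ((hf0i.add (hui.const_mul _)).const_mul 2) (.of_forall h)
      _ = 2 * ((∫ t, ‖f t‖ ^ 2) + ‖μ‖ ^ 4 * A) := by
          rw [integral_const_mul, integral_add hf0i (hui.const_mul _), integral_const_mul]
      _ ≤ _ := by gcongr
  set C := ∫ t, ‖deriv (deriv u) t‖ ^ 2
  have hμA : ‖μ‖ ^ 2 * A ≤ 16 * I := by linarith
  have hsq : ∀ {k x y : ℝ}, 0 ≤ x → 0 ≤ k → x ^ 2 ≤ k ^ 2 * y → x ≤ k * √y := by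
    intro k x y hx hk h
    rw [← Real.sqrt_sq hx, ← Real.sqrt_sq hk, ← Real.sqrt_mul (sq_nonneg k)]
    exact Real.sqrt_le_sqrt h
  have hTB : √B ≤ 4 * √I := by
    refine hsq (by positivity) (by norm_num) ?_
    rw [Real.sq_sqrt hB0]
    nlinarith [mul_nonneg (sq_nonneg ‖μ‖) hA0]
  have hTA : ν * √A ≤ 4 * √I := by
    refine hsq (by positivity) (by norm_num) ?_
    rw [mul_pow, Real.sq_sqrt hA0]
    nlinarith [mul_le_mul_of_nonneg_right hνμ hA0]
  have hTC : ν / (1 + ν ^ 2) * √C ≤ 6 * √I := by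
    refine hsq (by positivity) (by norm_num) ?_
    have hC0 : 0 ≤ C := integral_nonneg fun t => by positivity
    rw [mul_pow, Real.sq_sqrt hC0, div_pow, div_mul_eq_mul_div, div_le_iff₀ (by positivity)]
    have h1 : ‖μ‖ ^ 4 * A ≤ (1 + ν ^ 2) * (16 * I) := by
      calc ‖μ‖ ^ 4 * A = ‖μ‖ ^ 2 * (‖μ‖ ^ 2 * A) := by ring
        _ ≤ _ := by gcongr
    have h2 : ν ^ 2 * C ≤ ν ^ 2 * (2 * (I + (1 + ν ^ 2) * (16 * I))) := by
      gcongr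
      linarith
    have h3 : 0 ≤ ν ^ 2 * I := by positivity
    have h4 : 0 ≤ ν ^ 2 * (ν ^ 2 * I) := by positivity
    nlinarith
  linarith
end

section
/- Let ν > 0 and ε ∈ ℝ with |ε| < 1, set α = |ε|/ν and ⟨t⟩ = (1+t²)^{1/2}. Let u : ℝ → ℂ be twice continuously differentiable and suppose there is δ > |ε|/(2ν) with ∫_ℝ e^{2δ⟨t⟩}(|u(t)|² + |u′(t)|² + |u″(t)|²) dt < ∞. Set f(t) = u″(t) + (ν² − iε)u(t). Then ∫_ℝ e^{α|t|} |u′(t)|² dt ≤ 4 ∫_ℝ |f(t)|² t² e^{α|t|} dt. -/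
open MeasureTheory Real

lemma hasDerivAt_mul_exp_mul_abs (α t : ℝ) :
    HasDerivAt (fun s : ℝ => s * Real.exp (α * |s|)) (Real.exp (α * |t|) * (1 + α * |t|)) t := by
  have key : ∀ s : ℝ, s ≠ 0 →
      HasDerivAt (fun s : ℝ => s * Real.exp (α * |s|))
        (Real.exp (α * |s|) * (1 + α * |s|)) s := by
    intro s hs
    have h := (hasDerivAt_id s).mul (((hasDerivAt_abs hs).const_mul α).exp)
    refine h.congr_deriv ?_
    have : s * (SignType.sign s : ℝ) = |s| := self_mul_sign s
    simp only [id_eq]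
    linear_combination Real.exp (α * |s|) * α * this
  rcases eq_or_ne t 0 with rfl | ht
  · exact hasDerivAt_of_hasDerivAt_of_ne
      (g := fun s : ℝ => Real.exp (α * |s|) * (1 + α * |s|)) (fun s hs => key s hs)
      (by fun_prop) (by fun_prop)
  · exact key t ht

lemma one_add_sq_mul_exp_le {α δ : ℝ} (hα : 0 ≤ α) (hδ : α < 2 * δ) (t : ℝ) :
    (1 + |t|) ^ 2 * Real.exp (α * |t|) ≤
      (1 + 2 / (2 * δ - α)) ^ 2 * Real.exp (2 * δ * √(1 + t ^ 2)) := by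
  set c := 2 * δ - α with hc
  have hcpos : 0 < c := by linarith
  have ht : |t| ≤ √(1 + t ^ 2) := Real.abs_le_sqrt (by linarith)
  have h1 : 1 ≤ Real.exp (c / 2 * |t|) := Real.one_le_exp (by positivity)
  have h2 : c / 2 * |t| ≤ Real.exp (c / 2 * |t|) := by
    linarith [Real.add_one_le_exp (c / 2 * |t|)]
  have h3 : 1 + |t| ≤ (1 + 2 / c) * Real.exp (c / 2 * |t|) := by
    have : |t| = 2 / c * (c / 2 * |t|) := by field_simp
    have h4 : 2 / c * (c / 2 * |t|) ≤ 2 / c * Real.exp (c / 2 * |t|) := by gcongr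
    linarith
  calc (1 + |t|) ^ 2 * Real.exp (α * |t|)
      ≤ ((1 + 2 / c) * Real.exp (c / 2 * |t|)) ^ 2 * Real.exp (α * |t|) := by gcongr
    _ = (1 + 2 / c) ^ 2 * Real.exp (2 * δ * |t|) := by
        rw [mul_pow, mul_assoc, ← Real.exp_nat_mul, ← Real.exp_add]
        congr 2
        push_cast
        rw [hc]
        ring
    _ ≤ (1 + 2 / c) ^ 2 * Real.exp (2 * δ * √(1 + t ^ 2)) := by
        have : 0 ≤ 2 * δ := by linarith
        gcongr

lemma integrable_of_abs_le_one_add_sq_mul_exp {α δ : ℝ} (hα : 0 ≤ α) (hδ : α < 2 * δ)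
    {S g : ℝ → ℝ} (hS : ∀ t, 0 ≤ S t)
    (hint : Integrable (fun t : ℝ => Real.exp (2 * δ * √(1 + t ^ 2)) * S t))
    (hg : Continuous g) {K : ℝ} (hK : 0 ≤ K)
    (hle : ∀ t, |g t| ≤ (1 + |t|) ^ 2 * Real.exp (α * |t|) * (K * S t)) :
    Integrable g := by
  refine (hint.const_mul ((1 + 2 / (2 * δ - α)) ^ 2 * K)).mono' hg.aestronglyMeasurable
    (Filter.Eventually.of_forall fun t => ?_)
  have h := mul_le_mul_of_nonneg_right (one_add_sq_mul_exp_le hα hδ t)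
    (mul_nonneg hK (hS t))
  rw [Real.norm_eq_abs]
  refine (hle t).trans (h.trans_eq ?_)
  ring

/-- The virial-type lower bound for the derivative of `t e^{α|t|} (|u'|² + ν²|u|²)`, at a point:
`a`, `b`, `c` are the values of `u`, `u'`, `u''`. -/
lemma half_sq_sub_le_deriv_weighted_energy {ν : ℝ} (hν : 0 < ν) (ε t : ℝ) (a b c : ℂ) :
    ‖b‖ ^ 2 / 2 - 2 * (‖c + ((ν : ℂ) ^ 2 - Complex.I * ε) * a‖ ^ 2 * t ^ 2) ≤
      (1 + |ε| / ν * |t|) * (‖b‖ ^ 2 + ν ^ 2 * ‖a‖ ^ 2) +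
        t * (2 * inner ℝ b c + ν ^ 2 * (2 * inner ℝ a b)) := by
  set f := c + ((ν : ℂ) ^ 2 - Complex.I * ε) * a with hf
  have hE : inner ℝ b c + ν ^ 2 * inner ℝ a b =
      inner ℝ b f + ε * inner ℝ b (Complex.I * a) := by
    rw [hf]
    simp [Complex.inner, ← Complex.ofReal_pow]
    ring
  have h1 : |t * inner ℝ b f| ≤ |t| * (‖b‖ * ‖f‖) := by
    rw [abs_mul]
    gcongr
    exact abs_real_inner_le_norm b f
  have h2 : |t * (ε * inner ℝ b (Complex.I * a))| ≤ |t| * (|ε| * (‖b‖ * ‖a‖)) := by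
    rw [abs_mul, abs_mul]
    gcongr
    simpa using abs_real_inner_le_norm b (Complex.I * a)
  have h3 : 2 * (|t| * (|ε| * (‖b‖ * ‖a‖))) ≤
      |ε| / ν * |t| * (‖b‖ ^ 2 + ν ^ 2 * ‖a‖ ^ 2) := by
    have : 2 * (|t| * (|ε| * (‖b‖ * ‖a‖))) = |ε| / ν * |t| * (2 * ‖b‖ * (ν * ‖a‖)) := by
      field_simp
    rw [this]
    gcongr
    nlinarith [sq_nonneg (‖b‖ - ν * ‖a‖)]
  have h4 : 2 * (|t| * (‖b‖ * ‖f‖)) ≤ ‖b‖ ^ 2 / 2 + 2 * (‖f‖ ^ 2 * t ^ 2) := by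
    rw [← sq_abs t]
    nlinarith [sq_nonneg (‖b‖ - 2 * (|t| * ‖f‖))]
  have h5 : 0 ≤ ν ^ 2 * ‖a‖ ^ 2 := by positivity
  have h6 : t * (2 * inner ℝ b c + ν ^ 2 * (2 * inner ℝ a b)) =
      2 * (t * inner ℝ b f) + 2 * (t * (ε * inner ℝ b (Complex.I * a))) := by
    linear_combination 2 * t * hE
  rw [h6]
  linarith [neg_le_of_abs_le h1, neg_le_of_abs_le h2]

/-- First-derivative estimate for the 1-D Schrödinger equation `u″ + (ν² − iε)u = f`
with absorption: with `α = |ε|/ν`, if `∫ e^{2δ⟨t⟩}(|u|² + |u′|² + |u″|²) < ∞` for some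
`δ > |ε|/(2ν)`, then `∫ e^{α|t|}|u′(t)|² dt ≤ 4 ∫ |f(t)|² t² e^{α|t|} dt`. -/
theorem schrodinger_first_derivative_estimate (ν ε : ℝ) (hν : 0 < ν) (hε : |ε| < 1)
    (u : ℝ → ℂ) (hu : ContDiff ℝ 2 u)
    (hdecay : ∃ δ : ℝ, |ε| / (2 * ν) < δ ∧
      Integrable (fun t : ℝ => Real.exp (2 * δ * Real.sqrt (1 + t ^ 2)) *
        (‖u t‖ ^ 2 + ‖deriv u t‖ ^ 2 + ‖deriv (deriv u) t‖ ^ 2))) :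
    ∫ t : ℝ, Real.exp (|ε| / ν * |t|) * ‖deriv u t‖ ^ 2 ≤
      4 * ∫ t : ℝ, ‖deriv (deriv u) t + ((ν : ℂ) ^ 2 - Complex.I * ε) * u t‖ ^ 2 *
          t ^ 2 * Real.exp (|ε| / ν * |t|) := by
  obtain ⟨δ, hδ, hint⟩ := hdecay
  have hpt := fun t : ℝ =>
    half_sq_sub_le_deriv_weighted_energy hν ε t (u t) (deriv u t) (deriv (deriv u) t)
  set α := |ε| / ν with hαdef
  have hα : 0 ≤ α := by positivity
  have hαδ : α < 2 * δ := by
    have : |ε| / (2 * ν) = α / 2 := by rw [hαdef]; field_simp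
    linarith
  have hu1 : ContDiff ℝ 1 (deriv u) := by
    have h : ContDiff ℝ (1 + 1) u := by simpa [one_add_one_eq_two] using hu
    exact (contDiff_succ_iff_deriv.1 h).2.2
  have hd0 : ∀ t, HasDerivAt u (deriv u t) t := fun t =>
    (hu.differentiable (by norm_num)).differentiableAt.hasDerivAt
  have hd1 : ∀ t, HasDerivAt (deriv u) (deriv (deriv u) t) t := fun t =>
    (hu1.differentiable (by norm_num)).differentiableAt.hasDerivAt
  have hc0 : Continuous u := hu.continuous
  have hc1 : Continuous (deriv u) := hu1.continuous
  have hc2 : Continuous (deriv (deriv u)) := hu1.continuous_deriv (by norm_num)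
  generalize deriv (deriv u) = w at *
  generalize deriv u = v at *
  have hS : ∀ t, 0 ≤ ‖u t‖ ^ 2 + ‖v t‖ ^ 2 + ‖w t‖ ^ 2 := fun t => by positivity
  have hone : ∀ t : ℝ, 1 ≤ (1 + |t|) ^ 2 := fun t => one_le_pow₀ (by simp)
  have hle : ∀ t : ℝ, |t| ≤ (1 + |t|) ^ 2 := fun t => by nlinarith [abs_nonneg t]
  have hE : ∀ t, ‖v t‖ ^ 2 + ν ^ 2 * ‖u t‖ ^ 2 ≤
      (1 + ν ^ 2) * (‖u t‖ ^ 2 + ‖v t‖ ^ 2 + ‖w t‖ ^ 2) := fun t => by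
    have : 0 ≤ ν ^ 2 * (‖v t‖ ^ 2 + ‖w t‖ ^ 2) + ‖u t‖ ^ 2 + ‖w t‖ ^ 2 := by positivity
    linarith
  have hE' : ∀ t, |2 * inner ℝ (v t) (w t) + ν ^ 2 * (2 * inner ℝ (u t) (v t))| ≤
      (1 + ν ^ 2) * (‖u t‖ ^ 2 + ‖v t‖ ^ 2 + ‖w t‖ ^ 2) := fun t => by
    have h1 : |2 * inner ℝ (v t) (w t)| ≤ ‖u t‖ ^ 2 + ‖v t‖ ^ 2 + ‖w t‖ ^ 2 := by
      rw [abs_mul, abs_two]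
      nlinarith [abs_real_inner_le_norm (v t) (w t), sq_nonneg (‖v t‖ - ‖w t‖)]
    have h2 : |2 * inner ℝ (u t) (v t)| ≤ ‖u t‖ ^ 2 + ‖v t‖ ^ 2 + ‖w t‖ ^ 2 := by
      rw [abs_mul, abs_two]
      nlinarith [abs_real_inner_le_norm (u t) (v t), sq_nonneg (‖u t‖ - ‖v t‖)]
    refine (abs_add_le _ _).trans ?_
    rw [abs_mul (ν ^ 2), abs_of_nonneg (sq_nonneg ν)]
    nlinarith [mul_le_mul_of_nonneg_left h2 (sq_nonneg ν)]
  have hintA : Integrable (fun t => Real.exp (α * |t|) * ‖v t‖ ^ 2) := by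
    refine integrable_of_abs_le_one_add_sq_mul_exp hα hαδ hS hint (by fun_prop) zero_le_one
      fun t => ?_
    rw [abs_of_nonneg (by positivity), one_mul]
    gcongr
    · exact le_mul_of_one_le_left (Real.exp_nonneg _) (hone t)
    · linarith [sq_nonneg ‖u t‖, sq_nonneg ‖w t‖]
  have hintB : Integrable (fun t => ‖w t + ((ν : ℂ) ^ 2 - Complex.I * ε) * u t‖ ^ 2 *
      t ^ 2 * Real.exp (α * |t|)) := by
    set z := (ν : ℂ) ^ 2 - Complex.I * ε
    refine integrable_of_abs_le_one_add_sq_mul_exp hα hαδ hS hint (by fun_prop)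
      (K := 2 * (1 + ‖z‖ ^ 2)) (by positivity) fun t => ?_
    rw [abs_of_nonneg (by positivity)]
    have hf : ‖w t + z * u t‖ ^ 2 ≤
        2 * (1 + ‖z‖ ^ 2) * (‖u t‖ ^ 2 + ‖v t‖ ^ 2 + ‖w t‖ ^ 2) := by
      have h1 : ‖w t + z * u t‖ ≤ ‖w t‖ + ‖z‖ * ‖u t‖ := by
        simpa using norm_add_le (w t) (z * u t)
      have h2 : ‖w t + z * u t‖ ^ 2 ≤ (‖w t‖ + ‖z‖ * ‖u t‖) ^ 2 := by gcongr
      have h3 : 0 ≤ ‖z‖ ^ 2 * (‖v t‖ ^ 2 + ‖w t‖ ^ 2) + ‖u t‖ ^ 2 + ‖v t‖ ^ 2 := by positivity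
      nlinarith [sq_nonneg (‖w t‖ - ‖z‖ * ‖u t‖)]
    have ht : t ^ 2 ≤ (1 + |t|) ^ 2 := by
      rw [← sq_abs t]; gcongr; linarith
    calc ‖w t + z * u t‖ ^ 2 * t ^ 2 * Real.exp (α * |t|)
        = t ^ 2 * Real.exp (α * |t|) * ‖w t + z * u t‖ ^ 2 := by ring
      _ ≤ _ := by gcongr
  have hder : ∀ t, HasDerivAt
      (fun s => s * Real.exp (α * |s|) * (‖v s‖ ^ 2 + ν ^ 2 * ‖u s‖ ^ 2))
      (Real.exp (α * |t|) * ((1 + α * |t|) * (‖v t‖ ^ 2 + ν ^ 2 * ‖u t‖ ^ 2) +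
        t * (2 * inner ℝ (v t) (w t) + ν ^ 2 * (2 * inner ℝ (u t) (v t))))) t := fun t => by
    refine ((hasDerivAt_mul_exp_mul_abs α t).mul
      ((hd1 t).norm_sq.add ((hd0 t).norm_sq.const_mul (ν ^ 2)))).congr_deriv ?_
    simp only [Pi.add_apply]
    ring
  have hintG : Integrable
      (fun s => s * Real.exp (α * |s|) * (‖v s‖ ^ 2 + ν ^ 2 * ‖u s‖ ^ 2)) := by
    refine integrable_of_abs_le_one_add_sq_mul_exp hα hαδ hS hint (by fun_prop)
      (K := 1 + ν ^ 2) (by positivity) fun t => ?_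
    rw [abs_mul, abs_mul, abs_of_nonneg (Real.exp_nonneg _),
      abs_of_nonneg (by positivity : 0 ≤ ‖v t‖ ^ 2 + ν ^ 2 * ‖u t‖ ^ 2)]
    gcongr
    · exact hle t
    · exact hE t
  have hintG' : Integrable (fun t =>
      Real.exp (α * |t|) * ((1 + α * |t|) * (‖v t‖ ^ 2 + ν ^ 2 * ‖u t‖ ^ 2) +
        t * (2 * inner ℝ (v t) (w t) + ν ^ 2 * (2 * inner ℝ (u t) (v t))))) := by
    refine integrable_of_abs_le_one_add_sq_mul_exp hα hαδ hS hint (by fun_prop)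
      (K := (2 + α) * (1 + ν ^ 2)) (by positivity) fun t => ?_
    rw [abs_mul, abs_of_nonneg (Real.exp_nonneg _), mul_comm ((1 + |t|) ^ 2), mul_assoc]
    gcongr
    refine (abs_add_le _ _).trans ?_
    rw [abs_mul, abs_mul t, abs_of_nonneg (by positivity : 0 ≤ 1 + α * |t|),
      abs_of_nonneg (by positivity : 0 ≤ ‖v t‖ ^ 2 + ν ^ 2 * ‖u t‖ ^ 2)]
    have hw : 1 + α * |t| ≤ (1 + α) * (1 + |t|) ^ 2 := by
      nlinarith [hone t, mul_le_mul_of_nonneg_left (hle t) hα]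
    have hP := mul_le_mul hw (hE t) (by positivity) (by positivity)
    have hQ := mul_le_mul (hle t) (hE' t) (abs_nonneg _) (by positivity)
    linarith
  have hzero := integral_eq_zero_of_hasDerivAt_of_integrable hder hintG' hintG
  have hmono := integral_mono ((hintA.div_const 2).sub (hintB.const_mul 2)) hintG' fun t => by
    have := mul_le_mul_of_nonneg_left (hpt t) (Real.exp_nonneg (α * |t|))
    simp only [Pi.sub_apply]
    refine le_trans (le_of_eq ?_) this
    ring
  rw [hzero] at hmono
  simp only [Pi.sub_apply] at hmono
  rw [integral_sub (hintA.div_const 2) (hintB.const_mul 2), integral_div,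
    integral_const_mul] at hmono
  linarith
end

section
/- Let ν > 0, β > 0 and 0 < ε ≤ 2βν, and let μ be the complex square root of ν² − iε with Re μ > 0. Then |Im μ| ≤ ε/(2ν) ≤ β, and there is an absolute constant c (one may take c = π), independent of ν, β, ε, such that for every measurable f : ℝ²₊ → ℂ with ∫_{ℝ²₊} e^{2β⟨x₁⟩}(1+x₁²)(1+x₂²)|f(x)|² dx < ∞, the function f(x)e^{iμx₁ − νx₂} is integrable over ℝ²₊ and | ∫_{ℝ²₊} f(x) e^{iμx₁ − νx₂} dx | ≤ c ( ∫_{ℝ²₊} e^{2β⟨x₁⟩}(1+x₁²)(1+x₂²)|f(x)|² dx )^{1/2}. -/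
open Set MeasureTheory

/-- The open upper half-plane `ℝ²₊ = {x₂ > 0}`. -/
def upperHalf : Set (ℝ × ℝ) := {p : ℝ × ℝ | 0 < p.2}

/-- If a function is dominated by a product of two square-integrable functions, it is integrable
and its integral obeys the Cauchy–Schwarz bound. -/
theorem integrable_and_norm_integral_le_of_norm_le_mul {α E : Type*} [MeasurableSpace α]
    [NormedAddCommGroup E] [NormedSpace ℝ E] {m : Measure α} {F : α → E} {g h : α → ℝ}
    (hF : AEStronglyMeasurable F m) (hgm : AEStronglyMeasurable g m)
    (hhm : AEStronglyMeasurable h m) (hg0 : ∀ x, 0 ≤ g x) (hh0 : ∀ x, 0 ≤ h x)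
    (hg : Integrable (fun x => g x ^ 2) m) (hh : Integrable (fun x => h x ^ 2) m)
    (hle : ∀ᵐ x ∂m, ‖F x‖ ≤ g x * h x) :
    Integrable F m ∧
      ‖∫ x, F x ∂m‖ ≤ Real.sqrt (∫ x, h x ^ 2 ∂m) * Real.sqrt (∫ x, g x ^ 2 ∂m) := by
  have hgL : MemLp g 2 m := (memLp_two_iff_integrable_sq hgm).2 hg
  have hhL : MemLp h 2 m := (memLp_two_iff_integrable_sq hhm).2 hh
  have hgh : Integrable (fun x => g x * h x) m := hgL.integrable_mul hhL
  refine ⟨hgh.mono' hF hle, (norm_integral_le_of_norm_le hgh hle).trans ?_⟩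
  have hCS := integral_mul_le_Lp_mul_Lq_of_nonneg (μ := m) (f := g) (g := h)
    Real.HolderConjugate.two_two (ae_of_all _ hg0) (ae_of_all _ hh0)
    (by simpa using hgL) (by simpa using hhL)
  simp only [Real.rpow_two, ← Real.sqrt_eq_rpow] at hCS
  rwa [mul_comm (Real.sqrt _)]

/-- The decaying weight `1 / ((1 + x₁²)(1 + x₂²))` is integrable over the plane. -/
theorem integrable_inv_one_add_sq_mul_inv_one_add_sq :
    Integrable (fun p : ℝ × ℝ => (1 + p.1 ^ 2)⁻¹ * (1 + p.2 ^ 2)⁻¹) :=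
  integrable_inv_one_add_sq.mul_prod integrable_inv_one_add_sq

/-- The integral of `1 / ((1 + x₁²)(1 + x₂²))` over the plane is `π²`. -/
theorem integral_inv_one_add_sq_mul_inv_one_add_sq :
    ∫ p : ℝ × ℝ, (1 + p.1 ^ 2)⁻¹ * (1 + p.2 ^ 2)⁻¹ = Real.pi ^ 2 := by
  rw [sq, ← integral_univ_inv_one_add_sq]
  exact integral_prod_mul (fun x : ℝ => (1 + x ^ 2)⁻¹) (fun x : ℝ => (1 + x ^ 2)⁻¹)

/-- The square root of `ν² - iε` in the right half-plane has imaginary part at most `ε / (2ν)`. -/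
theorem abs_im_le_of_sq_eq {ν ε : ℝ} {μ : ℂ} (hν : 0 < ν) (hε : 0 < ε)
    (hμ : μ ^ 2 = (ν : ℂ) ^ 2 - Complex.I * ε) (hre : 0 < μ.re) :
    |μ.im| ≤ ε / (2 * ν) := by
  have h1 := congrArg Complex.re hμ
  have h2 := congrArg Complex.im hμ
  simp [sq] at h1 h2
  have hle : ν ≤ μ.re := by nlinarith [mul_self_nonneg μ.im]
  have hneg : μ.im < 0 := by nlinarith
  rw [abs_of_neg hneg, le_div_iff₀ (by positivity)]
  nlinarith

/-- Uniform bound for the wave-amplitude integrals in the limiting absorption procedure: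
if `μ² = ν² − iε`, `Re μ > 0`, with `0 < ε ≤ 2βν`, then `|Im μ| ≤ ε/(2ν) ≤ β`, and there
is an absolute constant `c` (one may take `c = π`), independent of `ν, β, ε`, such that
for every measurable `f` with finite weighted norm, `f e^{iμx₁−νx₂}` is integrable on
`ℝ²₊` and `|∫ f e^{iμx₁−νx₂}| ≤ c (∫ e^{2β⟨x₁⟩}(1+x₁²)(1+x₂²)|f|²)^{1/2}`. -/
theorem amplitude_integral_uniform_bound :
    ∃ c : ℝ, 0 < c ∧ ∀ (ν β ε : ℝ) (μ : ℂ),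
      0 < ν → 0 < β → 0 < ε → ε ≤ 2 * β * ν →
      μ ^ 2 = (ν : ℂ) ^ 2 - Complex.I * ε → 0 < μ.re →
      |μ.im| ≤ ε / (2 * ν) ∧ ε / (2 * ν) ≤ β ∧
      ∀ f : ℝ × ℝ → ℂ, Measurable f →
        IntegrableOn (fun p : ℝ × ℝ =>
          Real.exp (2 * β * Real.sqrt (1 + p.1 ^ 2)) * (1 + p.1 ^ 2) * (1 + p.2 ^ 2) *
            ‖f p‖ ^ 2) upperHalf →
        IntegrableOn (fun p : ℝ × ℝ =>
          f p * Complex.exp (Complex.I * μ * p.1 - ν * p.2)) upperHalf ∧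
        ‖∫ p in upperHalf, f p * Complex.exp (Complex.I * μ * p.1 - ν * p.2)‖ ≤
          c * Real.sqrt (∫ p in upperHalf,
            Real.exp (2 * β * Real.sqrt (1 + p.1 ^ 2)) * (1 + p.1 ^ 2) * (1 + p.2 ^ 2) *
              ‖f p‖ ^ 2) := by
  refine ⟨Real.pi, Real.pi_pos, fun ν β ε μ hν hβ hε hεβ hμ hre => ?_⟩
  have him := abs_im_le_of_sq_eq hν hε hμ hre
  have hεν : ε / (2 * ν) ≤ β := by
    rw [div_le_iff₀ (by positivity)]
    linarith
  refine ⟨him, hεν, fun f hf hfw => ?_⟩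
  set w : ℝ × ℝ → ℝ := fun p => Real.sqrt (1 + p.1 ^ 2) * Real.sqrt (1 + p.2 ^ 2) with hw
  have hw2 : ∀ p, w p ^ 2 = (1 + p.1 ^ 2) * (1 + p.2 ^ 2) := fun p => by
    rw [hw, mul_pow, Real.sq_sqrt (by positivity), Real.sq_sqrt (by positivity)]
  have hw0 : ∀ p, 0 < w p := fun p => by positivity
  have hwm : Measurable w := by fun_prop
  set g : ℝ × ℝ → ℝ := fun p => Real.exp (β * Real.sqrt (1 + p.1 ^ 2)) * w p * ‖f p‖ with hg
  have hg2 : ∀ p, g p ^ 2 = Real.exp (2 * β * Real.sqrt (1 + p.1 ^ 2)) * (1 + p.1 ^ 2) *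
      (1 + p.2 ^ 2) * ‖f p‖ ^ 2 := fun p => by
    rw [hg, mul_pow, mul_pow, hw2, ← Real.exp_nat_mul]
    push_cast
    ring_nf
  have hh2 : ∀ p, (w p)⁻¹ ^ 2 = (1 + p.1 ^ 2)⁻¹ * (1 + p.2 ^ 2)⁻¹ := fun p => by
    rw [inv_pow, hw2, mul_inv]
  have hdom : ∀ p ∈ upperHalf,
      ‖f p * Complex.exp (Complex.I * μ * p.1 - ν * p.2)‖ ≤ g p * (w p)⁻¹ := by
    intro p hp
    have hp2 : 0 < p.2 := hp
    have hgw : g p * (w p)⁻¹ = ‖f p‖ * Real.exp (β * Real.sqrt (1 + p.1 ^ 2)) := by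
      have := (hw0 p).ne'
      simp only [hg]
      field_simp
    rw [hgw, norm_mul, Complex.norm_exp]
    gcongr
    have habs : |p.1| ≤ Real.sqrt (1 + p.1 ^ 2) := Real.abs_le_sqrt (by linarith)
    have hmul : |μ.im * p.1| ≤ β * Real.sqrt (1 + p.1 ^ 2) := by
      rw [abs_mul]
      exact mul_le_mul (him.trans hεν) habs (abs_nonneg _) hβ.le
    have hre_eq : (Complex.I * μ * p.1 - ν * p.2).re = -(μ.im * p.1) - ν * p.2 := by simp
    rw [hre_eq]
    linarith [neg_abs_le (μ.im * p.1), mul_pos hν hp2]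
  have hmeas : MeasurableSet upperHalf := measurableSet_lt measurable_const measurable_snd
  have key := integrable_and_norm_integral_le_of_norm_le_mul
    (m := volume.restrict upperHalf)
    (F := fun p : ℝ × ℝ => f p * Complex.exp (Complex.I * μ * p.1 - ν * p.2))
    (g := g) (h := fun p => (w p)⁻¹)
    (by fun_prop) (by fun_prop) (by fun_prop)
    (fun p => by positivity) (fun p => (inv_pos.2 (hw0 p)).le)
    (by simpa only [IntegrableOn, hg2] using hfw)
    (by simpa only [IntegrableOn, hh2] using
      integrable_inv_one_add_sq_mul_inv_one_add_sq.integrableOn)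
    (ae_restrict_of_forall_mem hmeas hdom)
  simp only [hg2, hh2] at key
  refine ⟨key.1, key.2.trans ?_⟩
  gcongr
  rw [Real.sqrt_le_left Real.pi_pos.le, ← integral_inv_one_add_sq_mul_inv_one_add_sq]
  exact setIntegral_le_integral integrable_inv_one_add_sq_mul_inv_one_add_sq
    (ae_of_all _ fun p => by positivity)
end
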